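/- Let n ≥ 1, let Q = [0,1)^n with Lebesgue measure, let p > 1, let f, F be reals with 0 < f^p < F, and let z ∈ [1, p/(p-1)] satisfy -(p-1)z^p + p z^{p-1} = f^p/F. Let (φ_m)_{m∈ℕ} be a sequence of nonnegative measurable functions on Q with ∫_Q φ_m = f and ∫_Q φ_m^p = F for every m, and with lim_{m→∞} ∫_Q (Mφ_m)^p = F·z^p. Then lim_{m→∞} |{x ∈ Q : Mφ_m(x) = f}| = 0. -/

import Mathlib

open MeasureTheory Set Filter

noncomputable section

/-- The unit cube `[0,1)^n` in `ℝ^n`. -/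
def unitCube (n : ℕ) : Set (Fin n → ℝ) := Set.univ.pi fun _ => Set.Ico (0:ℝ) 1

/-- A dyadic subcube of the unit cube: a product of intervals
`[k_i 2^{-N}, (k_i+1) 2^{-N})` with `0 ≤ k_i < 2^N`. -/
def IsDyadicCube (n : ℕ) (R : Set (Fin n → ℝ)) : Prop :=
  ∃ (N : ℕ) (k : Fin n → ℕ), (∀ i, k i < 2 ^ N) ∧
    R = Set.univ.pi fun i => Set.Ico ((k i : ℝ) / 2 ^ N) (((k i : ℝ) + 1) / 2 ^ N)

/-- The (localized) dyadic maximal operator on the unit cube: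
`Mφ(x) = sup { (1/|R|) ∫_R φ : x ∈ R, R a dyadic subcube of Q }`. -/
def dyadicMax (n : ℕ) (φ : (Fin n → ℝ) → ℝ) (x : Fin n → ℝ) : ℝ :=
  sSup { a : ℝ | ∃ R : Set (Fin n → ℝ), IsDyadicCube n R ∧ x ∈ R ∧
    a = ((volume R).toReal)⁻¹ * ∫ y in R, φ y }

/-- The dyadic maximal operator localized to a dyadic subcube `J`:
the supremum is taken only over dyadic subcubes contained in `J`. -/
def dyadicMaxIn (n : ℕ) (J : Set (Fin n → ℝ)) (φ : (Fin n → ℝ) → ℝ)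
    (x : Fin n → ℝ) : ℝ :=
  sSup { a : ℝ | ∃ R : Set (Fin n → ℝ), IsDyadicCube n R ∧ R ⊆ J ∧ x ∈ R ∧
    a = ((volume R).toReal)⁻¹ * ∫ y in R, φ y }

lemma tangent {p x y : ℝ} (hp : 1 < p) (hx : 0 ≤ x) (hy : 0 < y) :
    y ^ p + p * y ^ (p - 1) * (x - y) ≤ x ^ p := by
  have h := one_add_mul_self_le_rpow_one_add (s := x / y - 1) (by
    have : 0 ≤ x / y := by positivity
    linarith) hp.le
  have h2 : 1 + (x / y - 1) = x / y := by ring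
  rw [h2, Real.div_rpow hx hy.le] at h
  have hyp : 0 < y ^ p := Real.rpow_pos_of_pos hy p
  rw [le_div_iff₀ hyp] at h
  have e : y ^ p = y ^ (p - 1) * y := by
    rw [← Real.rpow_add_one hy.ne']; congr 1; ring
  refine le_trans (le_of_eq ?_) h
  rw [e]; field_simp

lemma layer {Ω : Type*} [MeasurableSpace Ω] (μ : Measure Ω) [IsProbabilityMeasure μ]
    {q f : ℝ} (hq : 0 < q) (hf : 0 < f) {w M : Ω → ℝ} (hw0 : ∀ x, 0 ≤ w x)
    (hw : Measurable w) (hM : Measurable M) (hfM : ∀ᵐ x ∂μ, f ≤ M x)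
    (hwi : Integrable w μ) (hwM : Integrable (fun x => w x * M x ^ q) μ) :
    IntegrableOn (fun l : ℝ => l ^ (q - 1) * ∫ x in {x | l < M x}, w x ∂μ) (Ioi f) ∧
    ∫ l in Ioi f, l ^ (q - 1) * ∫ x in {x | l < M x}, w x ∂μ =
      (∫ x, w x * M x ^ q ∂μ - f ^ q * ∫ x, w x ∂μ) / q := by
  set G : Ω → ℝ → ℝ := fun x l => (Iio (M x)).indicator (fun l : ℝ => l ^ (q - 1) * w x) l with hG
  have hGm : Measurable (Function.uncurry G) := by
    have : Function.uncurry G = {a : Ω × ℝ | a.2 < M a.1}.indicator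
        (fun a => a.2 ^ (q - 1) * w a.1) := by
      ext a; simp [G, Function.uncurry, indicator]
    rw [this]
    refine Measurable.indicator ?_ ?_
    · fun_prop
    · exact measurableSet_lt measurable_snd (hM.comp measurable_fst)
  have hG0 : ∀ x, ∀ l ∈ Ioi f, 0 ≤ G x l := by
    intro x l hl
    have : 0 < l := hf.trans hl
    have h1 := hw0 x
    simp only [hG, indicator]
    split_ifs <;> positivity
  have hslice : ∀ x, f ≤ M x → IntegrableOn (G x) (Ioi f) ∧
      ∫ l in Ioi f, G x l = w x * ((M x ^ q - f ^ q) / q) := by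
    intro x hx
    have hset : Iio (M x) ∩ Ioi f = Ioo f (M x) := by ext; simp [and_comm]
    have hi : IntervalIntegrable (fun l : ℝ => l ^ (q - 1)) volume f (M x) :=
      intervalIntegral.intervalIntegrable_rpow' (by linarith)
    constructor
    · rw [IntegrableOn, hG, integrable_indicator_iff measurableSet_Iio, IntegrableOn, 
        Measure.restrict_restrict measurableSet_Iio, hset]
      rw [intervalIntegrable_iff_integrableOn_Ioo_of_le hx] at hi
      exact hi.mul_const _
    · simp only [hG]
      rw [integral_indicator measurableSet_Iio, Measure.restrict_restrict measurableSet_Iio, hset,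
        integral_mul_const, ← integral_Ioc_eq_integral_Ioo, ← intervalIntegral.integral_of_le hx,
        integral_rpow (Or.inl (by linarith))]
      simp only [sub_add_cancel]; ring
  have hval : Integrable (fun x => w x * ((M x ^ q - f ^ q) / q)) μ := by
    have := (hwM.sub (hwi.const_mul (f ^ q))).div_const q
    refine this.congr (Eventually.of_forall fun x => ?_)
    simp; ring
  have hint : Integrable (Function.uncurry G) (μ.prod (volume.restrict (Ioi f))) := by
    rw [integrable_prod_iff hGm.aestronglyMeasurable]
    constructor
    · filter_upwards [hfM] with x hx using (hslice x hx).1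
    · refine hval.congr ?_
      filter_upwards [hfM] with x hx
      rw [← (hslice x hx).2]
      refine setIntegral_congr_fun measurableSet_Ioi fun l hl => ?_
      simp [Function.uncurry, abs_of_nonneg (hG0 x l hl)]
  have hin : ∀ l, ∫ x, G x l ∂μ = l ^ (q - 1) * ∫ x in {x | l < M x}, w x ∂μ := by
    intro l
    rw [← integral_indicator (measurableSet_lt measurable_const hM), ← integral_const_mul]
    congr 1; ext x; simp [hG, indicator]
  constructor
  · have := hint.integral_prod_right
    simp only [Function.uncurry_apply_pair, hin] at this
    exact this
  · have := integral_integral_swap hint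
    simp only [hin] at this
    rw [← this]
    rw [integral_congr_ae (g := fun x => w x * ((M x ^ q - f ^ q) / q))
      (by filter_upwards [hfM] with x hx using (hslice x hx).2)]
    rw [← integral_const_mul, ← integral_sub hwM (hwi.const_mul _), ← integral_div]
    congr 1; ext x; ring

lemma core {Ω : Type*} [MeasurableSpace Ω] (μ : Measure Ω) [IsProbabilityMeasure μ]
    {p f z : ℝ} (hp : 1 < p) (hf : 0 < f) (hz : 1 ≤ z) {φ M : Ω → ℝ} (hφ0 : ∀ x, 0 ≤ φ x)
    (hφ : Measurable φ) (hM : Measurable M) (hfM : ∀ᵐ x ∂μ, f ≤ M x)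
    (hφM : ∀ᵐ x ∂μ, φ x ≤ M x)
    (hφi : Integrable φ μ) (hφp : Integrable (fun x => φ x ^ p) μ)
    (hMp : Integrable (fun x => M x ^ p) μ) (h1 : ∫ x, φ x ∂μ = f)
    (hweak : ∀ l, f < l → l * μ.real {x | l < M x} ≤ ∫ x in {x | l < M x}, φ x ∂μ) :
    ∃ d J : ℝ, 0 ≤ d ∧
      p * (p - 1) * ((d / 2) * (((f + d / 2) ^ (p - 1) - f ^ (p - 1)) / (p - 1)))
        ≤ p * J - (p - 1) * (∫ x, M x ^ p ∂μ) - f ^ p ∧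
      (z ^ p + p - 1 - p * z) * f ^ p * μ.real {x | M x = f} ≤
        z ^ p * (∫ x, φ x ^ p ∂μ) + (p - 1) * (∫ x, M x ^ p ∂μ) - p * z * J
          + (p * z ^ p * f ^ (p - 1) - p * z * f ^ (p - 1)) * d ∧
      0 ≤ z ^ p * (∫ x, φ x ^ p ∂μ) + (p - 1) * (∫ x, M x ^ p ∂μ) - p * z * J := by
  have hpow : ∀ y : ℝ, 0 < y → y ^ p = y ^ (p - 1) * y := fun y hy => by
    rw [← Real.rpow_add_one hy.ne']; congr 1; ring
  have hJ : Integrable (fun x => φ x * M x ^ (p - 1)) μ := by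
    refine ((hφp.add (hMp.const_mul (p - 1))).div_const p).mono'
      (by fun_prop) ?_
    filter_upwards [hfM] with x hx
    have hMx : 0 < M x := hf.trans_le hx
    have := tangent hp (hφ0 x) hMx
    rw [Real.norm_of_nonneg (mul_nonneg (hφ0 x) (Real.rpow_nonneg hMx.le _))]
    rw [le_div_iff₀ (by linarith)]
    simp only [Pi.add_apply]
    have e := hpow _ hMx
    nlinarith
  have hA : MeasurableSet {x | M x = f} := measurableSet_eq_fun hM measurable_const
  have hdi : Integrable (fun x => f - φ x) μ := (integrable_const f).sub hφi
  set d := ∫ x in {x | M x = f}, (f - φ x) ∂μ with hd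
  have hd0 : 0 ≤ d := by
    refine setIntegral_nonneg_of_ae_restrict ?_
    filter_upwards [ae_restrict_of_ae hφM, ae_restrict_mem hA] with x h1 h2
    have h2 : M x = f := h2
    simp only [Pi.zero_apply]; linarith
  refine ⟨d, ∫ x, φ x * M x ^ (p - 1) ∂μ, hd0, ?_, ?_⟩
  · obtain ⟨i1, e1⟩ := layer μ (q := p - 1) (by linarith) hf hφ0 hφ hM hfM hφi hJ
    obtain ⟨i2, e2⟩ := layer μ (q := p) (w := fun _ => 1) (by linarith) hf (fun _ => zero_le_one)
      measurable_const hM hfM (integrable_const 1) (by simpa using hMp)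
    have hs : ∀ l, f < l → max 0 (d - (l - f)) ≤
        (∫ x in {x | l < M x}, φ x ∂μ) - l * μ.real {x | l < M x} := by
      intro l hl
      refine max_le (by linarith [hweak l hl]) ?_
      have hm : MeasurableSet {x | l < M x} := measurableSet_lt measurable_const hM
      have hli : Integrable (fun x => l - φ x) μ := (integrable_const l).sub hφi
      have hc := integral_add_compl hm hli
      have hc2 : ∫ x, (l - φ x) ∂μ = l - f := by
        rw [integral_sub (integrable_const l) hφi, h1]; simp
      have hc3 : ∫ x in {x | l < M x}, (l - φ x) ∂μ =
          l * μ.real {x | l < M x} - ∫ x in {x | l < M x}, φ x ∂μ := by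
        rw [integral_sub (integrable_const l) hφi.integrableOn]; simp [mul_comm]
      have hc4 : d ≤ ∫ x in {x | l < M x}ᶜ, (l - φ x) ∂μ := by
        calc d ≤ ∫ x in {x | M x = f}, (l - φ x) ∂μ := by
              refine setIntegral_mono hdi.integrableOn
                hli.integrableOn fun x => ?_
              linarith
          _ ≤ _ := by
              refine setIntegral_mono_set hli.integrableOn ?_ ?_
              · filter_upwards [ae_restrict_of_ae hφM, ae_restrict_mem hm.compl] with x h1 h2
                simp only [mem_compl_iff, mem_ofPred_eq, not_lt] at h2
                simp only [Pi.zero_apply]; linarith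
              · refine Eventually.of_forall fun x hx => ?_
                have hx : M x = f := hx
                change ¬ (l < M x)
                linarith
      rw [hc2, hc3] at hc
      linarith
    have hD : ∫ l in Ioi f, l ^ (p - 1 - 1) * ((∫ x in {x | l < M x}, φ x ∂μ)
        - l * μ.real {x | l < M x}) = ((∫ x, φ x * M x ^ (p - 1) ∂μ) - f ^ p) / (p - 1)
          - ((∫ x, M x ^ p ∂μ) - f ^ p) / p := by
      have e3 : f ^ (p - 1) * f = f ^ p := (hpow f hf).symm
      have e1' := e1
      rw [h1, e3] at e1'
      simp only [one_mul, integral_const, probReal_univ, smul_eq_mul, mul_one] at e2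
      rw [← e1', ← e2, ← integral_sub i1 (by simpa [IntegrableOn] using i2)]
      refine setIntegral_congr_fun measurableSet_Ioi fun l hl => ?_
      have hl0 : 0 < l := hf.trans hl
      have : l ^ (p - 1) = l ^ (p - 1 - 1) * l := by
        rw [← Real.rpow_add_one hl0.ne']; congr 1; ring
      simp [this]; ring
    have hDi : IntegrableOn (fun l : ℝ => l ^ (p - 1 - 1) * ((∫ x in {x | l < M x}, φ x ∂μ)
        - l * μ.real {x | l < M x})) (Ioi f) := by
      refine (i1.sub i2).congr_fun (fun l hl => ?_) measurableSet_Ioi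
      have hl0 : 0 < l := hf.trans hl
      have : l ^ (p - 1) = l ^ (p - 1 - 1) * l := by
        rw [← Real.rpow_add_one hl0.ne']; congr 1; ring
      simp [this]; ring
    have hlow : (d / 2) * (((f + d / 2) ^ (p - 1) - f ^ (p - 1)) / (p - 1)) ≤
        ∫ l in Ioi f, l ^ (p - 1 - 1) * ((∫ x in {x | l < M x}, φ x ∂μ)
        - l * μ.real {x | l < M x}) := by
      have hle : f ≤ f + d / 2 := by linarith
      have hi : IntervalIntegrable (fun l : ℝ => l ^ (p - 1 - 1)) volume f (f + d / 2) :=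
        intervalIntegral.intervalIntegrable_rpow' (by linarith)
      rw [intervalIntegrable_iff_integrableOn_Ioc_of_le hle] at hi
      have e4 := integral_rpow (a := f) (b := f + d / 2) (r := p - 1 - 1)
        (Or.inl (by linarith))
      simp only [sub_add_cancel] at e4
      rw [← e4, intervalIntegral.integral_of_le hle, ← integral_const_mul]
      calc _ ≤ ∫ l in Ioc f (f + d / 2), l ^ (p - 1 - 1) * ((∫ x in {x | l < M x}, φ x ∂μ)
                - l * μ.real {x | l < M x}) := by
            refine setIntegral_mono_on (hi.const_mul _) (hDi.mono_set Ioc_subset_Ioi_self)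
              measurableSet_Ioc fun l hl => ?_
            have h5 := (le_max_right _ _).trans (hs l hl.1)
            have h6 := hl.2
            have h7 : 0 ≤ l ^ (p - 1 - 1) := Real.rpow_nonneg (hf.trans hl.1).le _
            rw [mul_comm]
            exact mul_le_mul_of_nonneg_left (by linarith) h7
        _ ≤ _ := by
            refine setIntegral_mono_set hDi ?_ (Ioc_subset_Ioi_self.eventuallyLE)
            filter_upwards [ae_restrict_mem measurableSet_Ioi] with l hl
            exact mul_nonneg (Real.rpow_nonneg (hf.trans hl).le _)
              ((le_max_left _ _).trans (hs l hl))
    rw [hD] at hlow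
    have hpp : 0 ≤ p * (p - 1) := mul_nonneg (by linarith) (by linarith)
    refine (mul_le_mul_of_nonneg_left hlow hpp).trans (le_of_eq ?_)
    have : p - 1 ≠ 0 := by linarith
    have : p ≠ 0 := by linarith
    field_simp
    ring
  · have hgi : Integrable (fun x => z ^ p * φ x ^ p + (p - 1) * M x ^ p
        - p * z * (φ x * M x ^ (p - 1))) μ :=
      ((hφp.const_mul _).add (hMp.const_mul _)).sub (hJ.const_mul _)
    have hge : ∫ x, (z ^ p * φ x ^ p + (p - 1) * M x ^ p
        - p * z * (φ x * M x ^ (p - 1))) ∂μ = z ^ p * (∫ x, φ x ^ p ∂μ)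
        + (p - 1) * (∫ x, M x ^ p ∂μ) - p * z * (∫ x, φ x * M x ^ (p - 1) ∂μ) := by
      have hadd : Integrable (fun x => z ^ p * φ x ^ p + (p - 1) * M x ^ p) μ :=
        (hφp.const_mul _).add (hMp.const_mul _)
      rw [integral_sub hadd (hJ.const_mul _),
        integral_add (hφp.const_mul _) (hMp.const_mul _), integral_const_mul,
        integral_const_mul, integral_const_mul]
    rw [← hge]
    have hz0 : 0 < z := by linarith
    have hgnn : 0 ≤ᵐ[μ] fun x => z ^ p * φ x ^ p + (p - 1) * M x ^ p
        - p * z * (φ x * M x ^ (p - 1)) := by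
      filter_upwards [hfM] with x hx
      have hMx : 0 < M x := hf.trans_le hx
      have t := tangent hp (mul_nonneg hz0.le (hφ0 x)) hMx
      rw [Real.mul_rpow hz0.le (hφ0 x)] at t
      have e := hpow _ hMx
      simp only [Pi.zero_apply]
      nlinarith
    have g1 : ∫ x in {x | M x = f}, ((z ^ p + p - 1 - p * z) * f ^ p -
        (p * z ^ p * f ^ (p - 1) - p * z * f ^ (p - 1)) * (f - φ x)) ∂μ ≤
        ∫ x in {x | M x = f}, (z ^ p * φ x ^ p + (p - 1) * M x ^ p
        - p * z * (φ x * M x ^ (p - 1))) ∂μ := by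
      refine setIntegral_mono_on ((integrable_const _).sub (hdi.const_mul _)).integrableOn
        hgi.integrableOn hA fun x hx => ?_
      have hx : M x = f := hx
      rw [hx]
      have t := tangent hp (mul_nonneg hz0.le (hφ0 x)) (mul_pos hz0 hf)
      rw [Real.mul_rpow hz0.le (hφ0 x), Real.mul_rpow hz0.le hf.le,
        Real.mul_rpow hz0.le hf.le] at t
      have ez := hpow z hz0
      have ef := hpow f hf
      refine le_trans (le_of_eq ?_) (add_le_add_left (add_le_add_left t ((p - 1) * f ^ p))
        (- (p * z * (φ x * f ^ (p - 1)))))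
      rw [ez, ef]; ring
    have g2 : ∫ x in {x | M x = f}, (z ^ p * φ x ^ p + (p - 1) * M x ^ p
        - p * z * (φ x * M x ^ (p - 1))) ∂μ ≤ ∫ x, (z ^ p * φ x ^ p + (p - 1) * M x ^ p
        - p * z * (φ x * M x ^ (p - 1))) ∂μ := by
      exact setIntegral_le_integral hgi hgnn
    rw [integral_sub (integrable_const _) (hdi.const_mul _).integrableOn,
      integral_const_mul (p * z ^ p * f ^ (p - 1) - p * z * f ^ (p - 1))] at g1
    simp only [integral_const, smul_eq_mul, measureReal_restrict_apply_univ] at g1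
    rw [← hd] at g1
    exact ⟨by linarith, integral_nonneg_of_ae hgnn⟩

/-- The dyadic cube of generation `N` with index `k`. -/
def dCube (n N : ℕ) (k : Fin n → ℕ) : Set (Fin n → ℝ) :=
  Set.univ.pi fun i => Set.Ico ((k i : ℝ) / 2 ^ N) (((k i : ℝ) + 1) / 2 ^ N)

/-- The index of the generation `N` dyadic cube containing `x`. -/
def dIdx (n N : ℕ) (x : Fin n → ℝ) : Fin n → ℕ := fun i => ⌊2 ^ N * x i⌋₊

/-- The average over the dyadic cube. -/
def dAvg (n : ℕ) (φ : (Fin n → ℝ) → ℝ) (N : ℕ) (k : Fin n → ℕ) : ℝ :=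
  ((volume (dCube n N k)).toReal)⁻¹ * ∫ y in dCube n N k, φ y

lemma mem_dCube {n N : ℕ} {k : Fin n → ℕ} {x : Fin n → ℝ} (hx : ∀ i, 0 ≤ x i) :
    x ∈ dCube n N k ↔ dIdx n N x = k := by
  have h2 : (0 : ℝ) < 2 ^ N := by positivity
  simp only [dCube, dIdx, Set.mem_univ_pi, Set.mem_Ico, funext_iff]
  refine forall_congr' fun i => ?_
  rw [Nat.floor_eq_iff (mul_nonneg h2.le (hx i)), div_le_iff₀ h2, lt_div_iff₀ h2,
    mul_comm (x i)]

lemma nonneg_of_mem_dCube {n N : ℕ} {k : Fin n → ℕ} {x : Fin n → ℝ} (hx : x ∈ dCube n N k) :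
    ∀ i, 0 ≤ x i := fun i => le_trans (by positivity) (hx i (mem_univ i)).1

lemma dIdx_lt {n N : ℕ} {x : Fin n → ℝ} (hx : x ∈ unitCube n) (i : Fin n) :
    dIdx n N x i < 2 ^ N := by
  have h := hx i (mem_univ i)
  have h2 : (0 : ℝ) < 2 ^ N := by positivity
  rw [dIdx, Nat.floor_lt (mul_nonneg h2.le h.1)]
  push_cast
  nlinarith [h.2]

lemma dCube_subset {n N : ℕ} {k : Fin n → ℕ} (hk : ∀ i, k i < 2 ^ N) :
    dCube n N k ⊆ unitCube n := by
  intro x hx i _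
  have h := hx i (mem_univ i)
  refine ⟨nonneg_of_mem_dCube hx i, h.2.trans_le ?_⟩
  rw [div_le_one (by positivity)]
  exact_mod_cast hk i

lemma dIdx_mono {n N j : ℕ} (hj : j ≤ N) {x y : Fin n → ℝ} (h : dIdx n N x = dIdx n N y) :
    dIdx n j x = dIdx n j y := by
  have key : ∀ t : ℝ, ⌊2 ^ j * t⌋₊ = ⌊2 ^ N * t⌋₊ / 2 ^ (N - j) := by
    intro t
    rw [← Nat.floor_div_natCast]
    congr 1
    push_cast
    rw [eq_div_iff (by positivity)]
    have : (2 : ℝ) ^ N = 2 ^ j * 2 ^ (N - j) := by rw [← pow_add]; congr 1; omega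
    rw [this]; ring
  ext i
  have := congrFun h i
  simp only [dIdx] at this ⊢
  rw [key, key, this]

lemma measurable_dIdx (n N : ℕ) : Measurable (dIdx n N) := by
  unfold dIdx
  refine measurable_pi_lambda _ fun i => ?_
  exact Nat.measurable_floor.comp (by fun_prop)

lemma measurableSet_dCube (n N : ℕ) (k : Fin n → ℕ) : MeasurableSet (dCube n N k) :=
  MeasurableSet.univ_pi fun _ => measurableSet_Ico

lemma measurableSet_unitCube (n : ℕ) : MeasurableSet (unitCube n) :=
  MeasurableSet.univ_pi fun _ => measurableSet_Ico

lemma volume_unitCube (n : ℕ) : volume (unitCube n) = 1 := by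
  rw [unitCube, Real.volume_pi_Ico (a := fun _ => 0) (b := fun _ => 1)]; simp

lemma volume_dCube_pos (n N : ℕ) (k : Fin n → ℕ) : 0 < (volume (dCube n N k)).toReal := by
  rw [dCube, Real.volume_pi_Ico_toReal]
  · refine Finset.prod_pos fun i _ => ?_
    rw [← sub_div]; simp
  · intro i
    simp only
    gcongr
    linarith

lemma volume_dCube_ne_top (n N : ℕ) (k : Fin n → ℕ) : volume (dCube n N k) ≠ ⊤ := fun h => by
  have := volume_dCube_pos n N k
  simp [h] at this

lemma measurable_dAvg (n : ℕ) (φ : (Fin n → ℝ) → ℝ) (N : ℕ) :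
    Measurable fun x => dAvg n φ N (dIdx n N x) :=
  (measurable_of_countable (dAvg n φ N)).comp (measurable_dIdx n N)

lemma nonneg_of_mem_unitCube {n : ℕ} {x : Fin n → ℝ} (hx : x ∈ unitCube n) : ∀ i, 0 ≤ x i :=
  fun i => (hx i (mem_univ i)).1

lemma dyadicMax_eq {n : ℕ} (φ : (Fin n → ℝ) → ℝ) {x : Fin n → ℝ} (hx : x ∈ unitCube n) :
    dyadicMax n φ x = ⨆ N, dAvg n φ N (dIdx n N x) := by
  rw [dyadicMax, iSup]
  congr 1
  ext a
  constructor
  · rintro ⟨R, ⟨N, k, hk, rfl⟩, hxR, rfl⟩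
    have : dIdx n N x = k := (mem_dCube (nonneg_of_mem_unitCube hx)).1 hxR
    exact ⟨N, by simp only [this]; rfl⟩
  · rintro ⟨N, rfl⟩
    exact ⟨dCube n N (dIdx n N x), ⟨N, _, fun i => dIdx_lt hx i, rfl⟩,
      (mem_dCube (nonneg_of_mem_unitCube hx)).2 rfl, rfl⟩

lemma weak_lintegral {n : ℕ} {φ : (Fin n → ℝ) → ℝ} (hφ0 : ∀ x, 0 ≤ φ x)
    (hφi : IntegrableOn φ (unitCube n)) (l : ℝ) (hl : 0 ≤ l) :
    ENNReal.ofReal l * volume {x ∈ unitCube n | ∃ N, l < dAvg n φ N (dIdx n N x)} ≤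
      ∫⁻ x in {x ∈ unitCube n | ∃ N, l < dAvg n φ N (dIdx n N x)}, ENNReal.ofReal (φ x) := by
  set S : ℕ → Set (Fin n → ℝ) := fun N => {x | x ∈ unitCube n ∧ l < dAvg n φ N (dIdx n N x) ∧
    ∀ j < N, dAvg n φ j (dIdx n j x) ≤ l} with hS
  have hSm : ∀ N, MeasurableSet (S N) := by
    intro N
    have e : S N = unitCube n ∩ ({x | l < dAvg n φ N (dIdx n N x)} ∩
        ⋂ j, ⋂ (_ : j < N), {x | dAvg n φ j (dIdx n j x) ≤ l}) := by
      ext x; simp [hS]; tauto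
    rw [e]
    refine (measurableSet_unitCube n).inter
      ((measurableSet_lt measurable_const (measurable_dAvg n φ N)).inter ?_)
    exact MeasurableSet.iInter fun j => MeasurableSet.iInter fun _ =>
      measurableSet_le (measurable_dAvg n φ j) measurable_const
  set T : ℕ × (Fin n → ℕ) → Set (Fin n → ℝ) := fun a => S a.1 ∩ {x | dIdx n a.1 x = a.2} with hT
  have hTm : ∀ a, MeasurableSet (T a) := fun a =>
    (hSm a.1).inter (measurable_dIdx n a.1 (measurableSet_singleton a.2))
  have hU : {x ∈ unitCube n | ∃ N, l < dAvg n φ N (dIdx n N x)} = ⋃ a, T a := by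
    classical
    ext x
    simp only [mem_iUnion]
    constructor
    · rintro ⟨hx, h⟩
      refine ⟨(Nat.find h, dIdx n (Nat.find h) x), ⟨hx, Nat.find_spec h, fun j hj => ?_⟩, rfl⟩
      exact not_lt.1 (Nat.find_min h hj)
    · rintro ⟨a, ⟨hx, h, _⟩, _⟩
      exact ⟨hx, a.1, h⟩
  have hdis : Pairwise (Function.onFun Disjoint T) := by
    rintro ⟨N, k⟩ ⟨N', k'⟩ hne
    refine Set.disjoint_left.2 ?_
    rintro x ⟨⟨_, h1, h2⟩, h3⟩ ⟨⟨_, h1', h2'⟩, h3'⟩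
    simp only at h1 h2 h1' h2'
    have hN : N = N' := by
      rcases lt_trichotomy N N' with h | h | h
      · exact absurd (h2' N h) (not_le.2 h1)
      · exact h
      · exact absurd (h2 N' h) (not_le.2 h1')
    subst hN
    exact hne (by rw [← (show dIdx n N x = k from h3), ← (show dIdx n N x = k' from h3')])
  have hone : ∀ a, ENNReal.ofReal l * volume (T a) ≤ ∫⁻ x in T a, ENNReal.ofReal (φ x) := by
    rintro ⟨N, k⟩
    rcases (T (N, k)).eq_empty_or_nonempty with h | ⟨x, ⟨hx, h1, h2⟩, h3⟩
    · simp [h]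
    have h3 : dIdx n N x = k := h3
    simp only at h1 h2
    have hk : ∀ i, k i < 2 ^ N := fun i => h3 ▸ dIdx_lt hx i
    have hTe : T (N, k) = dCube n N k := by
      ext y
      constructor
      · rintro ⟨⟨hy, _⟩, hy2⟩
        exact (mem_dCube (nonneg_of_mem_unitCube hy)).2 hy2
      · intro hy
        have hy2 : dIdx n N y = k := (mem_dCube (nonneg_of_mem_dCube hy)).1 hy
        refine ⟨⟨dCube_subset hk hy, ?_, fun j hj => ?_⟩, hy2⟩
        · simp only; rw [hy2, ← h3]; exact h1
        · rw [dIdx_mono hj.le (hy2.trans h3.symm)]; exact h2 j hj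
    rw [hTe, ← ofReal_integral_eq_lintegral_ofReal (hφi.mono_set (dCube_subset hk))
      (Eventually.of_forall hφ0), ← ENNReal.ofReal_toReal (volume_dCube_ne_top n N k),
      ← ENNReal.ofReal_mul hl]
    refine ENNReal.ofReal_le_ofReal ?_
    rw [h3, dAvg, ← div_eq_inv_mul, lt_div_iff₀ (volume_dCube_pos n N k)] at h1
    exact h1.le
  rw [hU, measure_iUnion hdis hTm, lintegral_iUnion hTm hdis, ← ENNReal.tsum_mul_left]
  exact ENNReal.tsum_le_tsum hone

lemma ae_bdd {n : ℕ} {φ : (Fin n → ℝ) → ℝ} (hφ0 : ∀ x, 0 ≤ φ x)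
    (hφi : IntegrableOn φ (unitCube n)) :
    ∀ᵐ x ∂(volume.restrict (unitCube n)),
      BddAbove (range fun N => dAvg n φ N (dIdx n N x)) := by
  rw [ae_restrict_iff' (measurableSet_unitCube n), ae_iff]
  set C := ∫⁻ x in unitCube n, ENNReal.ofReal (φ x) with hC
  have hCt : C ≠ ⊤ := by
    rw [hC, ← ofReal_integral_eq_lintegral_ofReal hφi (Eventually.of_forall hφ0)]
    exact ENNReal.ofReal_ne_top
  set B := {x | ¬ (x ∈ unitCube n → BddAbove (range fun N => dAvg n φ N (dIdx n N x)))} with hB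
  have hle : ∀ m : ℕ, (m : ENNReal) * volume B ≤ C := by
    intro m
    have h := weak_lintegral hφ0 hφi (m : ℝ) (by positivity)
    rw [ENNReal.ofReal_natCast] at h
    refine (mul_le_mul_right (measure_mono ?_) _).trans
      (h.trans (lintegral_mono_set fun x hx => hx.1))
    intro x hx
    have hx' : x ∈ unitCube n ∧ ¬ BddAbove (range fun N => dAvg n φ N (dIdx n N x)) := by
      simpa [hB] using hx
    refine ⟨hx'.1, ?_⟩
    obtain ⟨_, ⟨N, rfl⟩, hN⟩ := not_bddAbove_iff.1 hx'.2 m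
    exact ⟨N, hN⟩
  by_contra hne
  have hvt : volume B ≠ ⊤ := by
    have : volume B ≤ volume (unitCube n) := by
      refine measure_mono fun x hx => ?_
      by_contra hx2
      exact hx fun h => absurd h hx2
    rw [volume_unitCube] at this
    exact ne_top_of_le_ne_top ENNReal.one_ne_top this
  obtain ⟨m, hm⟩ := ENNReal.exists_nat_mul_gt hne hCt
  exact absurd (hle m) (not_le.2 hm)

lemma ae_le {n : ℕ} {φ : (Fin n → ℝ) → ℝ} (hφ0 : ∀ x, 0 ≤ φ x)
    (hφi : IntegrableOn φ (unitCube n)) :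
    ∀ᵐ x ∂(volume.restrict (unitCube n)), φ x ≤ ⨆ N, dAvg n φ N (dIdx n N x) := by
  have hgi : Integrable ((unitCube n).indicator φ) volume :=
    (integrable_indicator_iff (measurableSet_unitCube n)).2 hφi
  have hL := IsUnifLocDoublingMeasure.ae_tendsto_average (volume : Measure (Fin n → ℝ))
    hgi.locallyIntegrable 1
  filter_upwards [ae_bdd hφ0 hφi, ae_restrict_of_ae hL,
    ae_restrict_mem (measurableSet_unitCube n)] with x hb hx hxQ
  have hcb : ∀ N (k : Fin n → ℕ), Metric.closedBall (fun i => ((k i : ℝ) + 1 / 2) / 2 ^ N)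
      ((1 / 2) / 2 ^ N) = Icc (fun i => (k i : ℝ) / 2 ^ N) (fun i => ((k i : ℝ) + 1) / 2 ^ N) := by
    intro N k
    rw [closedBall_pi _ (by positivity), ← pi_univ_Icc]
    congr 1
    ext i : 1
    rw [Real.Icc_eq_closedBall]
    congr 1 <;> ring
  have hcae : ∀ N (k : Fin n → ℕ), dCube n N k =ᵐ[volume]
      Metric.closedBall (fun i => ((k i : ℝ) + 1 / 2) / 2 ^ N) ((1 / 2) / 2 ^ N) := by
    intro N k
    rw [hcb]
    exact Measure.univ_pi_Ico_ae_eq_Icc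
  have ht := hx (l := atTop) (fun (N : ℕ) i => ((dIdx n N x i : ℝ) + 1 / 2) / 2 ^ N)
    (fun N => (1 / 2) / 2 ^ N) ?_ ?_
  · have heq : ∀ N : ℕ, ⨍ y in Metric.closedBall
        (fun i => ((dIdx n N x i : ℝ) + 1 / 2) / 2 ^ N) ((1 / 2) / 2 ^ N),
        (unitCube n).indicator φ y = dAvg n φ N (dIdx n N x) := by
      intro N
      rw [← setAverage_congr (hcae N _), setAverage_eq, dAvg, smul_eq_mul, Measure.real]
      congr 1
      refine setIntegral_congr_fun (measurableSet_dCube n N _) fun y hy => ?_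
      exact indicator_of_mem (dCube_subset (fun i => dIdx_lt hxQ i) hy) φ
    simp only [heq] at ht
    rw [indicator_of_mem hxQ] at ht
    exact le_of_tendsto' ht fun N => le_ciSup hb N
  · refine tendsto_nhdsWithin_iff.2 ⟨?_, Eventually.of_forall fun N => ?_⟩
    · have := (tendsto_pow_atTop_nhds_zero_of_lt_one (r := (1 / 2 : ℝ)) (by norm_num)
        (by norm_num)).const_mul (1 / 2 : ℝ)
      simp only [mul_zero] at this
      refine this.congr fun N => ?_
      rw [one_div_pow]; ring
    · simp only [mem_Ioi]; positivity
  · refine Eventually.of_forall fun N => ?_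
    simp only [one_mul]
    rw [hcb, ← pi_univ_Icc]
    have := (mem_dCube (N := N) (nonneg_of_mem_unitCube hxQ)).2 rfl
    exact fun i hi => Ico_subset_Icc_self (this i hi)

lemma avg_le_max {n : ℕ} {φ : (Fin n → ℝ) → ℝ} (hφ0 : ∀ x, 0 ≤ φ x)
    (hφi : IntegrableOn φ (unitCube n)) :
    ∀ᵐ x ∂(volume.restrict (unitCube n)),
      ∫ y in unitCube n, φ y ≤ ⨆ N, dAvg n φ N (dIdx n N x) := by
  filter_upwards [ae_bdd hφ0 hφi, ae_restrict_mem (measurableSet_unitCube n)] with x hb hxQ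
  refine le_trans (le_of_eq ?_) (le_ciSup hb 0)
  have h0 : dIdx n 0 x = fun _ => 0 := by
    ext i
    have := dIdx_lt (N := 0) hxQ i
    simpa using this
  have h1 : dCube n 0 (fun _ => 0) = unitCube n := by simp [dCube, unitCube]
  rw [h0, dAvg, h1, volume_unitCube]; simp

lemma weak_real {n : ℕ} {φ : (Fin n → ℝ) → ℝ} (hφ0 : ∀ x, 0 ≤ φ x)
    (hφi : IntegrableOn φ (unitCube n)) (l : ℝ) (hl : 0 ≤ l) :
    l * (volume.restrict (unitCube n)).real {x | l < ⨆ N, dAvg n φ N (dIdx n N x)} ≤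
      ∫ x in {x | l < ⨆ N, dAvg n φ N (dIdx n N x)}, φ x ∂(volume.restrict (unitCube n)) := by
  set E := {x | ∃ N, l < dAvg n φ N (dIdx n N x)} with hE
  have hEm : MeasurableSet E := by
    have : E = ⋃ N, {x | l < dAvg n φ N (dIdx n N x)} := by ext; simp [hE]
    rw [this]
    exact MeasurableSet.iUnion fun N => measurableSet_lt measurable_const (measurable_dAvg n φ N)
  have hae : {x | l < ⨆ N, dAvg n φ N (dIdx n N x)} =ᵐ[volume.restrict (unitCube n)] E := by
    filter_upwards [ae_bdd hφ0 hφi] with x hx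
    exact propext (lt_ciSup_iff hx)
  rw [setIntegral_congr_set hae, measureReal_congr hae, Measure.restrict_restrict hEm,
    measureReal_restrict_apply hEm]
  have e : E ∩ unitCube n = {x ∈ unitCube n | ∃ N, l < dAvg n φ N (dIdx n N x)} := by
    ext; simp [hE, and_comm]
  have h := weak_lintegral hφ0 hφi l hl
  rw [← e, ← ofReal_integral_eq_lintegral_ofReal (hφi.mono_set inter_subset_right)
      (Eventually.of_forall hφ0)] at h
  have hfin : volume (E ∩ unitCube n) ≠ ⊤ :=
    ne_top_of_le_ne_top (by rw [volume_unitCube]; exact ENNReal.one_ne_top)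
      (measure_mono inter_subset_right)
  rw [← ENNReal.ofReal_toReal hfin, ← ENNReal.ofReal_mul hl] at h
  exact (ENNReal.ofReal_le_ofReal_iff (integral_nonneg hφ0)).1 h

/-- Along any extremal sequence (with `f^p < F`), the measure of the set where the
maximal function equals `f` tends to `0`. -/
theorem extremal_level_set_tendsto_zero (n : ℕ) (hn : 1 ≤ n) (p f F z : ℝ) (hp : 1 < p)
    (hf : 0 < f ^ p) (hfF : f ^ p < F)
    (hz : z ∈ Set.Icc 1 (p / (p - 1)))
    (hzeq : -(p - 1) * z ^ p + p * z ^ (p - 1) = f ^ p / F)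
    (φ : ℕ → (Fin n → ℝ) → ℝ)
    (hφ0 : ∀ m x, 0 ≤ φ m x) (hφm : ∀ m, Measurable (φ m))
    (h1 : ∀ m, ∫ x in unitCube n, φ m x = f)
    (h2 : ∀ m, ∫ x in unitCube n, φ m x ^ p = F)
    (h3 : Tendsto (fun m => ∫ x in unitCube n, (dyadicMax n (φ m) x) ^ p)
      atTop (nhds (F * z ^ p))) :
    Tendsto (fun m => (volume {x ∈ unitCube n | dyadicMax n (φ m) x = f}).toReal)
      atTop (nhds 0) := by
  have hf0 : 0 < f := by
    have h0 : 0 ≤ f := by rw [← h1 0]; exact integral_nonneg (hφ0 0)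
    rcases h0.lt_or_eq with h | h
    · exact h
    · rw [← h, Real.zero_rpow (by linarith)] at hf
      exact absurd hf (lt_irrefl 0)
  have hF : 0 < F := hf.trans hfF
  have hz1 : 1 < z := by
    rcases hz.1.lt_or_eq with h | h
    · exact h
    · rw [← h, Real.one_rpow, Real.one_rpow, eq_div_iff hF.ne'] at hzeq
      linarith
  have hz0 : 0 < z := by linarith
  set μ := (volume : Measure (Fin n → ℝ)).restrict (unitCube n) with hμ
  have hprob : IsProbabilityMeasure μ := ⟨by
    rw [hμ, Measure.restrict_apply_univ, volume_unitCube]⟩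
  set M : ℕ → (Fin n → ℝ) → ℝ := fun m x => ⨆ N, dAvg n (φ m) N (dIdx n N x) with hMdef
  have hMeq : ∀ m, ∫ x in unitCube n, (dyadicMax n (φ m) x) ^ p = ∫ x, M m x ^ p ∂μ := by
    intro m
    refine setIntegral_congr_fun (measurableSet_unitCube n) fun x hx => ?_
    simp only [dyadicMax_eq (φ m) hx, hMdef]
  have hMm : ∀ m, Measurable (M m) := fun m => Measurable.iSup fun N => measurable_dAvg n (φ m) N
  have hAeq : ∀ m, (volume {x ∈ unitCube n | dyadicMax n (φ m) x = f}).toReal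
      = μ.real {x | M m x = f} := by
    intro m
    rw [measureReal_restrict_apply (measurableSet_eq_fun (hMm m) measurable_const), Measure.real]
    congr 2
    ext x
    constructor
    · rintro ⟨hx, h⟩
      exact ⟨(dyadicMax_eq (φ m) hx).symm.trans h, hx⟩
    · rintro ⟨h, hx⟩
      exact ⟨hx, (dyadicMax_eq (φ m) hx).trans h⟩
  replace h3 : Tendsto (fun m => ∫ x, M m x ^ p ∂μ) atTop (nhds (F * z ^ p)) :=
    h3.congr hMeq
  refine Tendsto.congr (fun m => (hAeq m).symm) ?_
  have hφi : ∀ m, IntegrableOn (φ m) (unitCube n) := by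
    intro m
    by_contra h
    have := h1 m
    rw [integral_undef h] at this
    exact hf0.ne this
  have hφp : ∀ m, Integrable (fun x => φ m x ^ p) μ := by
    intro m
    by_contra h
    have := h2 m
    rw [integral_undef h] at this
    exact hF.ne this
  have hMp : ∀ᶠ m in atTop, Integrable (fun x => M m x ^ p) μ := by
    have hpos : 0 < F * z ^ p := mul_pos hF (Real.rpow_pos_of_pos hz0 p)
    filter_upwards [h3.eventually (lt_mem_nhds hpos)] with m hm
    by_contra h
    rw [integral_undef h] at hm
    exact lt_irrefl _ hm
  -- the quantity controlling everything
  set Z : ℕ → ℝ := fun m => z ^ p * F + (p - 1) * (∫ x, M m x ^ p ∂μ)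
    - z * (p - 1) * (∫ x, M m x ^ p ∂μ) - z * f ^ p with hZ
  have hZ0 : Tendsto Z atTop (nhds 0) := by
    have hpow : z ^ p = z ^ (p - 1) * z := by
      rw [← Real.rpow_add_one hz0.ne']; congr 1; ring
    have hfp : f ^ p = F * (-(p - 1) * z ^ p + p * z ^ (p - 1)) := by
      rw [hzeq]; field_simp
    have ht := (((tendsto_const_nhds (x := z ^ p * F)).add (h3.const_mul (p - 1))).sub
      (h3.const_mul (z * (p - 1)))).sub (tendsto_const_nhds (x := z * f ^ p))
    convert ht using 2
    rw [hfp, hpow]; ring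
  set ψ : ℝ → ℝ := fun d =>
    p * (p - 1) * ((d / 2) * (((f + d / 2) ^ (p - 1) - f ^ (p - 1)) / (p - 1))) with hψ
  have hψmono : ∀ d e, 0 ≤ d → d ≤ e → ψ d ≤ ψ e := by
    intro d e hd hde
    have hp1 : 0 < p - 1 := by linarith
    have m1 : f ^ (p - 1) ≤ (f + d / 2) ^ (p - 1) :=
      Real.rpow_le_rpow hf0.le (by linarith) hp1.le
    have m2 : (f + d / 2) ^ (p - 1) ≤ (f + e / 2) ^ (p - 1) :=
      Real.rpow_le_rpow (by linarith) (by linarith) hp1.le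
    simp only [hψ]
    refine mul_le_mul_of_nonneg_left ?_ (mul_nonneg (by linarith) hp1.le)
    refine mul_le_mul (by linarith) ?_ (div_nonneg (by linarith) hp1.le) (by linarith)
    exact div_le_div_of_nonneg_right (by linarith) hp1.le
  have hψpos : ∀ e, 0 < e → 0 < ψ e := by
    intro e he
    have hp1 : 0 < p - 1 := by linarith
    have m2 : f ^ (p - 1) < (f + e / 2) ^ (p - 1) :=
      Real.rpow_lt_rpow hf0.le (by linarith) hp1
    exact mul_pos (mul_pos (by linarith) hp1)
      (mul_pos (by linarith) (div_pos (by linarith) hp1))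
  set C := p * z ^ p * f ^ (p - 1) - p * z * f ^ (p - 1) with hC
  set κ := (z ^ p + p - 1 - p * z) * f ^ p with hκ
  have hκ0 : 0 < κ := by
    have := one_add_mul_self_lt_rpow_one_add (s := z - 1) (by linarith) (by linarith) hp
    rw [add_sub_cancel] at this
    exact mul_pos (by linarith) hf
  have hkey : ∀ᶠ m in atTop, ∃ d, 0 ≤ d ∧ z * ψ d ≤ Z m ∧
      κ * μ.real {x | M m x = f} ≤ Z m + C * d := by
    filter_upwards [hMp] with m hm
    obtain ⟨d, J, hd, c1, c2, hR⟩ := core μ hp hf0 hz1.le (hφ0 m) (hφm m) (hMm m)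
      (by have := avg_le_max (hφ0 m) (hφi m); rw [h1 m] at this; exact this)
      (ae_le (hφ0 m) (hφi m)) (hφi m) (hφp m) hm (h1 m)
      (fun l hl => weak_real (hφ0 m) (hφi m) l (hf0.trans hl).le)
    rw [h2 m] at c2 hR
    have hψ0 : 0 ≤ ψ d := by
      have := hψmono 0 d le_rfl hd
      simpa [hψ] using this
    have c1' := mul_le_mul_of_nonneg_left c1 hz0.le
    have c10 := mul_nonneg hz0.le hψ0
    refine ⟨d, hd, ?_, ?_⟩
    · simp only [hψ, hZ]; simp only [hψ] at c10; nlinarith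
    · simp only [hψ] at c10; simp only [hZ]; nlinarith
  -- conclusion
  rw [Metric.tendsto_nhds]
  intro ε hε
  have hη : 0 < κ * ε / (2 * (|C| + 1)) := by positivity
  have hb : 0 < min (z * ψ (κ * ε / (2 * (|C| + 1)))) (κ * ε / 2) :=
    lt_min (mul_pos hz0 (hψpos _ hη)) (by positivity)
  filter_upwards [hkey, hZ0.eventually (gt_mem_nhds hb)] with m hm hZm
  obtain ⟨d, hd, k1, k2⟩ := hm
  have hdη : d < κ * ε / (2 * (|C| + 1)) := by
    by_contra h
    have t1 := hψmono _ d hη.le (not_lt.1 h)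
    have t2 := mul_le_mul_of_nonneg_left t1 hz0.le
    have t3 := hZm.trans_le (min_le_left _ _)
    linarith
  have t4 := hZm.trans_le (min_le_right _ _)
  have hCd : C * d ≤ κ * ε / 2 := by
    rw [lt_div_iff₀ (by positivity)] at hdη
    have : C * d ≤ |C| * d := mul_le_mul_of_nonneg_right (le_abs_self C) hd
    nlinarith
  rw [Real.dist_eq, sub_zero, abs_of_nonneg measureReal_nonneg]
  have : κ * μ.real {x | M m x = f} < κ * ε := by linarith
  exact lt_of_mul_lt_mul_left this hκ0.le
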